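/- arXiv:2010.02766 — 2 statements merged into one kernel-verified Lean document; each statement's English description precedes it below -/
import Mathlib

section
/- Let (T,d) be an ℝ-tree and let a,b,c,d' ∈ T be points such that the geodesic segment ⟦a,b⟧ and the geodesic segment ⟦c,d'⟧ intersect in at most one point. Then d(a,c) + d(b,d') = d(a,d') + d(b,c). (Consequently, for a Gaussian process B on T with E[(B(x)−B(y))²] = d(x,y), the increments B(a)−B(b) and B(c)−B(d') are uncorrelated.) -/
open Set

/-- An ℝ-tree structure on a metric space `T`, given by a geodesic parametrization
`geo a b : ℝ → T` of the segment `⟦a,b⟧`: it starts at `a`, ends at `b`, is an isometry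
on `[0, dist a b]`, and the image of any injective continuous path from `a` to `b`
coincides with the segment (uniqueness of arcs). -/
structure IsRTree {T : Type*} [MetricSpace T] (geo : T → T → ℝ → T) : Prop where
  source : ∀ a b, geo a b 0 = a
  target : ∀ a b, geo a b (dist a b) = b
  isom : ∀ a b, ∀ s ∈ Set.Icc (0 : ℝ) (dist a b), ∀ u ∈ Set.Icc (0 : ℝ) (dist a b),
    dist (geo a b s) (geo a b u) = |s - u|
  unique_arc : ∀ a b (q : ℝ → T), ContinuousOn q (Set.Icc 0 1) →
    Set.InjOn q (Set.Icc 0 1) → q 0 = a → q 1 = b →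
    q '' Set.Icc 0 1 = geo a b '' Set.Icc 0 (dist a b)

/-- The geodesic segment `⟦a,b⟧` in an ℝ-tree. -/
def rtreeSegment {T : Type*} [MetricSpace T] (geo : T → T → ℝ → T) (a b : T) : Set T :=
  geo a b '' Set.Icc 0 (dist a b)

namespace RT

variable {T : Type*} [MetricSpace T] {geo : T → T → ℝ → T}

lemma left_mem (h : IsRTree geo) (a b : T) : a ∈ rtreeSegment geo a b :=
  ⟨0, ⟨le_refl _, dist_nonneg⟩, h.source a b⟩

lemma right_mem (h : IsRTree geo) (a b : T) : b ∈ rtreeSegment geo a b :=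
  ⟨dist a b, ⟨dist_nonneg, le_refl _⟩, h.target a b⟩

lemma dist_left (h : IsRTree geo) (a b : T) {s : ℝ} (hs : s ∈ Set.Icc 0 (dist a b)) :
    dist a (geo a b s) = s := by
  have := h.isom a b 0 ⟨le_refl _, dist_nonneg⟩ s hs
  rw [h.source] at this
  rw [this, zero_sub, abs_neg, abs_of_nonneg hs.1]

lemma dist_right (h : IsRTree geo) (a b : T) {s : ℝ} (hs : s ∈ Set.Icc 0 (dist a b)) :
    dist (geo a b s) b = dist a b - s := by
  have := h.isom a b s hs (dist a b) ⟨dist_nonneg, le_refl _⟩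
  rw [h.target] at this
  rw [this, abs_sub_comm, abs_of_nonneg (by linarith [hs.2])]

lemma dist_of_mem (h : IsRTree geo) {a b z : T} (hz : z ∈ rtreeSegment geo a b) :
    dist a z + dist z b = dist a b := by
  obtain ⟨s, hs, rfl⟩ := hz
  rw [dist_left h a b hs, dist_right h a b hs]; ring

lemma continuousOn_geo (h : IsRTree geo) (a b : T) :
    ContinuousOn (geo a b) (Set.Icc 0 (dist a b)) := by
  have : LipschitzOnWith 1 (geo a b) (Set.Icc 0 (dist a b)) := by
    apply LipschitzOnWith.of_dist_le_mul
    intro x hx y hy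
    rw [h.isom a b x hx y hy, Real.dist_eq]; simp
  exact this.continuousOn

lemma injOn_geo (h : IsRTree geo) (a b : T) :
    Set.InjOn (geo a b) (Set.Icc 0 (dist a b)) := by
  intro x hx y hy hxy
  rw [← dist_left h a b hx, ← dist_left h a b hy, hxy]

lemma join (h : IsRTree geo) {a x b : T}
    (H : ∀ z ∈ rtreeSegment geo a x, z ∈ rtreeSegment geo x b → z = x) :
    x ∈ rtreeSegment geo a b := by
  by_cases hax : a = x
  · subst hax; exact left_mem h _ _
  by_cases hxb : x = b
  · subst hxb; exact right_mem h _ _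
  have h1 : 0 < dist a x := dist_pos.2 hax
  have h2 : 0 < dist x b := dist_pos.2 hxb
  set f : ℝ → T := fun s => geo a x (2 * s * dist a x) with hf
  set g : ℝ → T := fun s => geo x b ((2 * s - 1) * dist x b) with hg
  set q : ℝ → T := fun s => if s ≤ 1/2 then f s else g s with hq
  have mf : ∀ s ∈ Set.Icc (0:ℝ) (1/2), 2 * s * dist a x ∈ Set.Icc 0 (dist a x) := by
    intro s hs
    exact ⟨by have := hs.1; positivity, by nlinarith [hs.2]⟩
  have mg : ∀ s ∈ Set.Icc (1/2:ℝ) 1, (2 * s - 1) * dist x b ∈ Set.Icc 0 (dist x b) := by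
    intro s hs
    exact ⟨mul_nonneg (by linarith [hs.1]) h2.le, by nlinarith [hs.2]⟩
  have qf : ∀ s ∈ Set.Icc (0:ℝ) (1/2), q s = f s := fun s hs => if_pos hs.2
  have fh : f (1/2) = x := by
    have : 2 * (1/2) * dist a x = dist a x := by ring
    simp only [hf, this, h.target]
  have gh : g (1/2) = x := by
    have : (2 * (1/2) - 1) * dist x b = 0 := by ring
    simp only [hg, this, h.source]
  have qg : ∀ s ∈ Set.Icc (1/2:ℝ) 1, q s = g s := by
    intro s hs
    by_cases hs' : s ≤ 1/2
    · have : s = 1/2 := le_antisymm hs' hs.1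
      subst this
      rw [gh, ← fh]; exact if_pos hs'
    · exact if_neg hs'
  have hcov : Set.Icc (0:ℝ) 1 = Set.Icc 0 (1/2) ∪ Set.Icc (1/2) 1 :=
    (Set.Icc_union_Icc_eq_Icc (by norm_num) (by norm_num)).symm
  have hcont : ContinuousOn q (Set.Icc 0 1) := by
    rw [hcov]
    apply ContinuousOn.union_of_isClosed _ _ isClosed_Icc isClosed_Icc
    · refine ContinuousOn.congr ?_ qf
      exact (continuousOn_geo h a x).comp (by fun_prop) mf
    · refine ContinuousOn.congr ?_ qg
      exact (continuousOn_geo h x b).comp (by fun_prop) mg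
  have finj : ∀ s ∈ Set.Icc (0:ℝ) (1/2), ∀ t ∈ Set.Icc (0:ℝ) (1/2), f s = f t → s = t := by
    intro s hs t ht hst
    have := injOn_geo h a x (mf s hs) (mf t ht) hst
    have := mul_right_cancel₀ h1.ne' this
    linarith
  have ginj : ∀ s ∈ Set.Icc (1/2:ℝ) 1, ∀ t ∈ Set.Icc (1/2:ℝ) 1, g s = g t → s = t := by
    intro s hs t ht hst
    have := injOn_geo h x b (mg s hs) (mg t ht) hst
    have := mul_right_cancel₀ h2.ne' this
    linarith
  have cross : ∀ s ∈ Set.Icc (0:ℝ) (1/2), ∀ t ∈ Set.Icc (1/2:ℝ) 1, f s = g t → s = t := by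
    intro s hs t ht hst
    have e : f s = x := H _ ⟨_, mf s hs, rfl⟩ (hst ▸ ⟨_, mg t ht, rfl⟩)
    have e1 := finj s hs (1/2) (by norm_num) (e.trans fh.symm)
    have e2 := ginj t ht (1/2) (by norm_num) ((hst.symm.trans e).trans gh.symm)
    rw [e1, e2]
  have hinj : Set.InjOn q (Set.Icc 0 1) := by
    rw [hcov]
    rintro s (hs | hs) t (ht | ht) hst
    · rw [qf s hs, qf t ht] at hst; exact finj s hs t ht hst
    · rw [qf s hs, qg t ht] at hst; exact cross s hs t ht hst
    · rw [qg s hs, qf t ht] at hst; exact (cross t ht s hs hst.symm).symm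
    · rw [qg s hs, qg t ht] at hst; exact ginj s hs t ht hst
  have q0 : q 0 = a := by
    rw [qf 0 (by norm_num)]
    simp only [hf, mul_zero, zero_mul, h.source]
  have q1 : q 1 = b := by
    rw [qg 1 (by norm_num)]
    have : (2 * 1 - 1) * dist x b = dist x b := by ring
    simp only [hg, this, h.target]
  have := h.unique_arc a b q hcont hinj q0 q1
  unfold rtreeSegment
  rw [← this]
  exact ⟨1/2, by norm_num, by rw [qf _ (by norm_num), fh]⟩

lemma mem_iff (h : IsRTree geo) {a b z : T} :
    z ∈ rtreeSegment geo a b ↔ dist a z + dist z b = dist a b := by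
  refine ⟨dist_of_mem h, fun hz => join h fun w hw1 hw2 => ?_⟩
  have e1 := dist_of_mem h hw1
  have e2 := dist_of_mem h hw2
  have := dist_triangle a w b
  rw [dist_comm z w] at e2
  exact dist_le_zero.1 (by linarith)

lemma symm (h : IsRTree geo) (a b : T) : rtreeSegment geo a b = rtreeSegment geo b a := by
  ext z
  rw [mem_iff h, mem_iff h, dist_comm a z, dist_comm z b, dist_comm a b, add_comm]

lemma sub_left (h : IsRTree geo) {a b p : T} (hp : p ∈ rtreeSegment geo a b) :
    rtreeSegment geo a p ⊆ rtreeSegment geo a b := by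
  intro z hz
  rw [mem_iff h] at *
  linarith [dist_triangle z p b, dist_triangle a z b]

lemma split (h : IsRTree geo) {a b p z : T} (hp : p ∈ rtreeSegment geo a b)
    (hz : z ∈ rtreeSegment geo a b) :
    z ∈ rtreeSegment geo a p ∨ z ∈ rtreeSegment geo p b := by
  rw [mem_iff h, mem_iff h]
  obtain ⟨s, hs, rfl⟩ := hp
  obtain ⟨t, ht, rfl⟩ := hz
  rw [dist_left h a b hs, dist_left h a b ht, dist_right h a b hs, dist_right h a b ht,
    h.isom a b s hs t ht, h.isom a b t ht s hs]
  rcases le_total t s with hts | hts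
  · left; rw [abs_of_nonpos (by linarith)]; ring
  · right; rw [abs_of_nonpos (by linarith)]; ring

lemma isCompact_seg (h : IsRTree geo) (a b : T) : IsCompact (rtreeSegment geo a b) :=
  isCompact_Icc.image_of_continuousOn (continuousOn_geo h a b)

lemma bridge (h : IsRTree geo) {I J : Set T} (hIJ : (I ∩ J).Subsingleton) {p q x y : T}
    (hp : p ∈ I) (hq : q ∈ J) (hmin : ∀ u ∈ I, ∀ v ∈ J, dist p q ≤ dist u v)
    (hx : rtreeSegment geo x p ⊆ I) (hy : rtreeSegment geo q y ⊆ J) :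
    dist x y = dist x p + dist p q + dist q y := by
  have m1 : p ∈ rtreeSegment geo x q := join h fun z hz1 hz2 => by
    have e := dist_of_mem h hz2
    have := hmin z (hx hz1) q hq
    rw [dist_comm p z] at e
    exact dist_le_zero.1 (by linarith)
  have m2 : q ∈ rtreeSegment geo x y := join h fun z hz1 hz2 => by
    have hzJ := hy hz2
    rcases split h m1 hz1 with hz | hz
    · have hzI := hx hz
      have := hmin z hzI z hzJ
      rw [dist_self] at this
      have hpq : p = q := dist_le_zero.1 this
      exact hIJ ⟨hzI, hzJ⟩ ⟨hpq ▸ hp, hq⟩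
    · have e := dist_of_mem h hz
      have := hmin p hp z hzJ
      exact dist_le_zero.1 (by linarith)
  have := dist_of_mem h m1
  have := dist_of_mem h m2
  linarith

end RT

/-- If the segments `⟦a,b⟧` and `⟦c,d'⟧` in an ℝ-tree intersect in at most one point, then
`d(a,c) + d(b,d') = d(a,d') + d(b,c)`. -/
theorem rtree_four_point {T : Type*} [MetricSpace T] (geo : T → T → ℝ → T)
    (h : IsRTree geo) (a b c d' : T)
    (hint : (rtreeSegment geo a b ∩ rtreeSegment geo c d').Subsingleton) :
    dist a c + dist b d' = dist a d' + dist b c := by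
  obtain ⟨⟨p, q⟩, ⟨hp, hq⟩, hm⟩ :=
    ((RT.isCompact_seg h a b).prod (RT.isCompact_seg h c d')).exists_isMinOn
      ⟨(a, c), RT.left_mem h a b, RT.left_mem h c d'⟩
      (f := fun z : T × T => dist z.1 z.2) (by fun_prop)
  simp only at hp hq
  have hmin : ∀ u ∈ rtreeSegment geo a b, ∀ v ∈ rtreeSegment geo c d', dist p q ≤ dist u v :=
    fun u hu v hv => hm (show (u, v) ∈ _ from ⟨hu, hv⟩)
  have ha := RT.sub_left h hp
  have hb : rtreeSegment geo b p ⊆ rtreeSegment geo a b := by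
    rw [RT.symm h a b] at hp ⊢; exact RT.sub_left h hp
  have hc : rtreeSegment geo q c ⊆ rtreeSegment geo c d' := by
    rw [RT.symm h q c]; exact RT.sub_left h hq
  have hd : rtreeSegment geo q d' ⊆ rtreeSegment geo c d' := by
    rw [RT.symm h q d']; rw [RT.symm h c d'] at hq ⊢; exact RT.sub_left h hq
  rw [RT.bridge h hint hp hq hmin ha hc, RT.bridge h hint hp hq hmin hb hd,
    RT.bridge h hint hp hq hmin ha hd, RT.bridge h hint hp hq hmin hb hc]
  ring
end

section
/- Let q ≥ 1 and φ_q(x) = exp(x^q) − 1. Let (T,d) be a compact metric space whose covering numbers satisfy N(T,ε) ≤ c·ε^{−θ} for all ε ∈ (0,1), for some constants c, θ > 0, and let (X(z))_{z∈T} be a stochastic process such that ‖X(z) − X(z')‖_{φ_q} ≤ c·d(z,z')^ν for all z,z' ∈ T, for some ν ∈ (0,1]. Then X admits a continuous modification, and there exists a random variable K with P(K ≥ u) ≤ C₁ exp(−C₂ u^q) (for constants C₁, C₂ depending only on c, θ, ν, q) such that almost surely |X(z) − X(z')| ≤ K · d(z,z')^ν · |log d(z,z')|^{1/q} for all z,z'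 ∈ T with d(z,z') < 1/2. -/
open MeasureTheory Set

/-- pointwise inversion of the exponential bound -/
lemma aux_ptwise (q β Δ a W : ℝ) (n : ℕ) (hq : 1 ≤ q) (hβ : 0 ≤ β) (hΔ : 0 ≤ Δ) (ha : 0 < a)
    (hW : 0 ≤ W) (h : Real.exp ((Δ / a) ^ q) - 1 ≤ Real.exp (β * (n + 1)) * W) :
    Δ ≤ a * ((n : ℝ) + 1) ^ (1 / q) * (β + Real.log (1 + W)) ^ (1 / q) := by
  have hq0 : 0 < q := by linarith
  have hn : (0 : ℝ) ≤ n := Nat.cast_nonneg n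
  have hlog : 0 ≤ Real.log (1 + W) := Real.log_nonneg (by linarith)
  have h1 : Real.exp ((Δ / a) ^ q) ≤ Real.exp (((n : ℝ) + 1) * (β + Real.log (1 + W))) := by
    have e1 : (1 : ℝ) ≤ Real.exp (β * (n + 1)) := Real.one_le_exp (by positivity)
    calc Real.exp ((Δ / a) ^ q) ≤ Real.exp (β * (n + 1)) * (1 + W) := by linarith
      _ = Real.exp (β * (n + 1) + Real.log (1 + W)) := by
          rw [Real.exp_add, Real.exp_log (by linarith)]
      _ ≤ _ := Real.exp_le_exp.2 (by nlinarith)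
  have h2 := Real.exp_le_exp.1 h1
  have h3 : Δ / a ≤ (((n : ℝ) + 1) * (β + Real.log (1 + W))) ^ (1 / q) := by
    have := Real.rpow_le_rpow (by positivity) h2 (by positivity : 0 ≤ 1 / q)
    rwa [← Real.rpow_mul (by positivity), mul_one_div_cancel hq0.ne', Real.rpow_one] at this
  rw [Real.mul_rpow (by positivity) (by positivity)] at h3
  rw [div_le_iff₀ ha] at h3
  linarith

lemma aux_prob {T Ω : Type} [MeasureSpace Ω] (X : T → Ω → ℝ) (hX : ∀ z, Measurable (X z))
    (q β C : ℝ) (hq : 1 ≤ q) (hβ : 0 ≤ β) (hC : 0 ≤ C)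
    (a : ℕ → ℝ) (ha : ∀ n, 0 < a n) (P : ℕ → Finset (T × T))
    (hcard : ∀ n, ((P n).card : ℝ) ≤ C * Real.exp ((β - 1) * (n + 1)))
    (h : ∀ n, ∀ p ∈ P n, ∫⁻ ω, ENNReal.ofReal
      (Real.exp ((|X p.1 ω - X p.2 ω| / a n) ^ q) - 1) ∂(volume : Measure Ω) ≤ 1) :
    ∃ W : Ω → ENNReal, Measurable W ∧ ∫⁻ ω, W ω ∂(volume : Measure Ω) ≤ ENNReal.ofReal C ∧
      ∀ ω, W ω ≠ ⊤ → ∀ n, ∀ p ∈ P n, |X p.1 ω - X p.2 ω| ≤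
        a n * ((n : ℝ) + 1) ^ (1 / q) * (β + Real.log (1 + (W ω).toReal)) ^ (1 / q) := by
  have hm : ∀ n (p : T × T), Measurable fun ω => ENNReal.ofReal
      (Real.exp ((|X p.1 ω - X p.2 ω| / a n) ^ q) - 1) := by
    intro n p
    have h1 := hX p.1
    have h2 := hX p.2
    have h3 : Measurable fun ω => |X p.1 ω - X p.2 ω| := (h1.sub h2).abs
    exact ((Real.measurable_exp.comp ((h3.div_const _).pow_const q)).sub_const 1).ennreal_ofReal
  refine ⟨fun ω => ∑' n, ∑ p ∈ P n, ENNReal.ofReal (Real.exp (-β * (n + 1))) * ENNReal.ofReal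
      (Real.exp ((|X p.1 ω - X p.2 ω| / a n) ^ q) - 1), ?_, ?_, ?_⟩
  · refine Measurable.tsum fun n => Finset.measurable_fun_sum _ fun p _ => ?_
    exact (hm n p).const_mul _
  · rw [lintegral_tsum (fun n => (Finset.measurable_fun_sum _ fun p _ =>
      (hm n p).const_mul _).aemeasurable)]
    calc _ ≤ ∑' n : ℕ, ENNReal.ofReal C * (2⁻¹ : ENNReal) ^ (n + 1) := by
          refine ENNReal.tsum_le_tsum fun n => ?_
          rw [lintegral_finsetSum _ (fun p _ => (hm n p).const_mul _)]
          calc _ ≤ ∑ p ∈ P n, ENNReal.ofReal (Real.exp (-β * (n + 1))) := by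
                refine Finset.sum_le_sum fun p hp => ?_
                rw [lintegral_const_mul _ (hm n p)]
                calc _ ≤ ENNReal.ofReal (Real.exp (-β * (n + 1))) * 1 := by
                      gcongr
                      exact h n p hp
                  _ = _ := mul_one _
            _ = ENNReal.ofReal (((P n).card : ℝ) * Real.exp (-β * (n + 1))) := by
                rw [Finset.sum_const, nsmul_eq_mul, ENNReal.ofReal_mul (by positivity)]
                simp
            _ ≤ ENNReal.ofReal (C * (2⁻¹ : ℝ) ^ (n + 1)) := by
                apply ENNReal.ofReal_le_ofReal
                have e2 : Real.exp (-1) ≤ 2⁻¹ := by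
                  rw [Real.exp_neg]
                  apply inv_anti₀ (by norm_num)
                  have := Real.add_one_le_exp (1 : ℝ)
                  linarith
                calc ((P n).card : ℝ) * Real.exp (-β * (n + 1))
                    ≤ C * Real.exp ((β - 1) * (n + 1)) * Real.exp (-β * (n + 1)) := by
                      gcongr
                      exact hcard n
                  _ = C * Real.exp (-1) ^ (n + 1) := by
                      rw [mul_assoc, ← Real.exp_add, ← Real.exp_nat_mul]
                      congr 2
                      push_cast
                      ring
                  _ ≤ _ := by gcongr
            _ = _ := by
                rw [ENNReal.ofReal_mul hC, ENNReal.ofReal_pow (by norm_num),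
                  ENNReal.ofReal_inv_of_pos (by norm_num)]
                simp
      _ = ENNReal.ofReal C := by
          rw [ENNReal.tsum_mul_left, ENNReal.tsum_geometric_add_one]
          simp [ENNReal.one_sub_inv_two, ENNReal.inv_mul_cancel]
  · intro ω hω n p hp
    refine aux_ptwise q β _ _ _ n hq hβ (abs_nonneg _) (ha n) ENNReal.toReal_nonneg ?_
    have h1 := (Finset.single_le_sum (f := fun p : T × T =>
        ENNReal.ofReal (Real.exp (-β * (n + 1))) * ENNReal.ofReal
        (Real.exp ((|X p.1 ω - X p.2 ω| / a n) ^ q) - 1)) (fun _ _ => zero_le) hp).trans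
        (ENNReal.le_tsum (f := fun n : ℕ => ∑ p ∈ P n,
          ENNReal.ofReal (Real.exp (-β * (n + 1))) * ENNReal.ofReal
          (Real.exp ((|X p.1 ω - X p.2 ω| / a n) ^ q) - 1)) n)
    have h2 := ENNReal.toReal_mono hω h1
    have hnn : 0 ≤ Real.exp ((|X p.1 ω - X p.2 ω| / a n) ^ q) - 1 := by
      have := Real.one_le_exp (x := (|X p.1 ω - X p.2 ω| / a n) ^ q)
        (Real.rpow_nonneg (div_nonneg (abs_nonneg _) (ha n).le) _)
      linarith
    simp only [ENNReal.toReal_mul] at h2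
    rw [ENNReal.toReal_ofReal (Real.exp_pos _).le, ENNReal.toReal_ofReal hnn, neg_mul,
      Real.exp_neg, inv_mul_le_iff₀ (Real.exp_pos _)] at h2
    exact h2

lemma aux_summable (ν : ℝ) (hν : 0 < ν) :
    Summable fun j : ℕ => (((1 : ℝ) / 2) ^ ν) ^ j * ((j : ℝ) + 1) := by
  have h0 : (0 : ℝ) < ((1 : ℝ) / 2) ^ ν := by positivity
  have h1 : ((1 : ℝ) / 2) ^ ν < 1 := Real.rpow_lt_one (by norm_num) (by norm_num) hν
  have hn : ‖((1 : ℝ) / 2) ^ ν‖ < 1 := by rwa [Real.norm_of_nonneg h0.le]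
  have a1 := summable_pow_mul_geometric_of_norm_lt_one 1 hn
  have a2 := summable_geometric_of_lt_one h0.le h1
  refine (a1.add a2).congr fun j => ?_
  ring

/-- the scale sequence -/
noncomputable def bseq (q ν : ℝ) (n : ℕ) : ℝ :=
  (((1 : ℝ) / 2) ^ (n + 1)) ^ ν * ((n : ℝ) + 1) ^ (1 / q)

lemma bseq_nonneg (q ν : ℝ) (n : ℕ) : 0 ≤ bseq q ν n := by unfold bseq; positivity

lemma bseq_add_le (q ν : ℝ) (hq : 1 ≤ q) (n k : ℕ) :
    bseq q ν (n + k) ≤ bseq q ν n * ((((1 : ℝ) / 2) ^ ν) ^ k * ((k : ℝ) + 1)) := by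
  unfold bseq
  have hq0 : 0 < q := by linarith
  have e1 : (((1 : ℝ) / 2) ^ (n + k + 1)) ^ ν
      = (((1 : ℝ) / 2) ^ (n + 1)) ^ ν * (((1 : ℝ) / 2) ^ ν) ^ k := by
    rw [show n + k + 1 = (n + 1) + k by ring, pow_add, Real.mul_rpow (by positivity) (by positivity)]
    congr 1
    rw [← Real.rpow_natCast, ← Real.rpow_natCast, ← Real.rpow_mul (by norm_num),
      ← Real.rpow_mul (by norm_num), mul_comm]
  have hk : (0 : ℝ) ≤ k := Nat.cast_nonneg k
  have hn : (0 : ℝ) ≤ n := Nat.cast_nonneg n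
  have e2 : (((n + k : ℕ) : ℝ) + 1) ^ (1 / q) ≤ ((n : ℝ) + 1) ^ (1 / q) * ((k : ℝ) + 1) := by
    calc (((n + k : ℕ) : ℝ) + 1) ^ (1 / q) ≤ (((n : ℝ) + 1) * ((k : ℝ) + 1)) ^ (1 / q) := by
          apply Real.rpow_le_rpow (by positivity) _ (by positivity)
          push_cast
          nlinarith
      _ = ((n : ℝ) + 1) ^ (1 / q) * ((k : ℝ) + 1) ^ (1 / q) :=
          Real.mul_rpow (by positivity) (by positivity)
      _ ≤ _ := by
          gcongr
          calc ((k : ℝ) + 1) ^ (1 / q) ≤ ((k : ℝ) + 1) ^ (1 : ℝ) := by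
                apply Real.rpow_le_rpow_of_exponent_le (by linarith)
                rw [div_le_one hq0]
                exact hq
            _ = _ := Real.rpow_one _
  rw [e1]
  calc _ ≤ (((1 : ℝ) / 2) ^ (n + 1)) ^ ν * (((1 : ℝ) / 2) ^ ν) ^ k *
        (((n : ℝ) + 1) ^ (1 / q) * ((k : ℝ) + 1)) := by gcongr
    _ = _ := by ring

/-- the chaining constant -/
noncomputable def kap (ν : ℝ) : ℝ := ∑' j : ℕ, (((1 : ℝ) / 2) ^ ν) ^ j * ((j : ℝ) + 1)

lemma kap_nonneg (ν : ℝ) : 0 ≤ kap ν := tsum_nonneg fun j => by positivity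

lemma bseq_summable (q ν : ℝ) (hq : 1 ≤ q) (hν : 0 < ν) : Summable (bseq q ν) := by
  refine Summable.of_nonneg_of_le (bseq_nonneg q ν) (fun k => ?_)
    ((aux_summable ν hν).mul_left (bseq q ν 0))
  simpa using bseq_add_le q ν hq 0 k

lemma bseq_tail (q ν : ℝ) (hq : 1 ≤ q) (hν : 0 < ν) (n : ℕ) :
    ∑' k, bseq q ν (n + k) ≤ kap ν * bseq q ν n := by
  have h1 := (aux_summable ν hν).mul_left (bseq q ν n)
  have h2 : Summable fun k => bseq q ν (n + k) :=
    Summable.of_nonneg_of_le (fun k => bseq_nonneg q ν _) (bseq_add_le q ν hq n) h1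
  calc _ ≤ _ := h2.tsum_le_tsum (bseq_add_le q ν hq n) h1
    _ = _ := by rw [tsum_mul_left, mul_comm, kap]

lemma aux_scale (q ν d : ℝ) (hq : 1 ≤ q) (hν : 0 < ν) (hν1 : ν ≤ 1) (hd : 0 < d)
    (hd2 : d < 1 / 2) : ∃ n : ℕ, d ≤ (1 / 2) ^ (n + 1) ∧
      bseq q ν n ≤ 4 * (d ^ ν * |Real.log d| ^ (1 / q)) := by
  have hq0 : 0 < q := by linarith
  obtain ⟨m, hm1, hm2⟩ := exists_nat_pow_near_of_lt_one hd (by linarith : d ≤ 1)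
    (by norm_num : (0 : ℝ) < 1 / 2) (by norm_num)
  obtain ⟨n, rfl⟩ : ∃ n, m = n + 1 := by
    rcases m with _ | n
    · norm_num at hm1
      linarith
    · exact ⟨n, rfl⟩
  refine ⟨n, hm2, ?_⟩
  unfold bseq
  have h1 : (((1 : ℝ) / 2) ^ (n + 1)) ^ ν ≤ 2 * d ^ ν := by
    calc (((1 : ℝ) / 2) ^ (n + 1)) ^ ν ≤ (2 * d) ^ ν := by
          apply Real.rpow_le_rpow (by positivity) _ hν.le
          rw [pow_succ] at hm1
          linarith
      _ = 2 ^ ν * d ^ ν := Real.mul_rpow (by norm_num) hd.le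
      _ ≤ 2 * d ^ ν := by
          gcongr
          calc (2 : ℝ) ^ ν ≤ 2 ^ (1 : ℝ) := Real.rpow_le_rpow_of_exponent_le (by norm_num) hν1
            _ = 2 := Real.rpow_one _
  have h2 : ((n : ℝ) + 1) ≤ 2 * |Real.log d| := by
    have hl := Real.log_le_log hd hm2
    rw [Real.log_pow, one_div, Real.log_inv] at hl
    have := Real.log_two_gt_d9
    have h3 := neg_le_abs (Real.log d)
    push_cast at hl
    have hn : (0 : ℝ) ≤ n := Nat.cast_nonneg n
    nlinarith
  have h3 : ((n : ℝ) + 1) ^ (1 / q) ≤ 2 * |Real.log d| ^ (1 / q) := by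
    calc ((n : ℝ) + 1) ^ (1 / q) ≤ (2 * |Real.log d|) ^ (1 / q) :=
          Real.rpow_le_rpow (by positivity) h2 (by positivity)
      _ = 2 ^ (1 / q) * |Real.log d| ^ (1 / q) := Real.mul_rpow (by norm_num) (abs_nonneg _)
      _ ≤ _ := by
          gcongr
          calc (2 : ℝ) ^ (1 / q) ≤ 2 ^ (1 : ℝ) := by
                apply Real.rpow_le_rpow_of_exponent_le (by norm_num)
                rw [div_le_one hq0]
                exact hq
            _ = 2 := Real.rpow_one _
  calc _ ≤ (2 * d ^ ν) * (2 * |Real.log d| ^ (1 / q)) := by gcongr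
    _ = _ := by ring

lemma aux_det {T : Type} [MetricSpace T] (q ν M : ℝ) (hq : 1 ≤ q) (hν : 0 < ν) (hν1 : ν ≤ 1)
    (hM : 0 ≤ M) (f : T → ℝ) (π : ℕ → T → T)
    (hπ : ∀ n z, dist z (π n z) ≤ (1 / 2) ^ (n + 1))
    (h1 : ∀ n z, |f (π n z) - f (π (n + 1) z)| ≤ M * bseq q ν n)
    (h2 : ∀ n z z', dist (π n z) (π n z') ≤ 3 * (1 / 2) ^ (n + 1) →
      |f (π n z) - f (π n z')| ≤ M * bseq q ν n) :
    ∃ g : T → ℝ, (∀ z, Filter.Tendsto (fun n => f (π n z)) Filter.atTop (nhds (g z))) ∧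
      Continuous g ∧ ∀ z z', dist z z' < 1 / 2 →
        |g z - g z'| ≤ (4 * (2 * kap ν + 1) * M) * dist z z' ^ ν
          * |Real.log (dist z z')| ^ (1 / q) := by
  have hs : Summable fun n => M * bseq q ν n := (bseq_summable q ν hq hν).mul_left M
  have hlim : ∀ z, ∃ y, Filter.Tendsto (fun n => f (π n z)) Filter.atTop (nhds y) := fun z =>
    cauchySeq_tendsto_of_complete
      (cauchySeq_of_dist_le_of_summable _ (fun n => by rw [Real.dist_eq]; exact h1 n z) hs)
  choose g hg using hlim
  have hgd : ∀ n z, |f (π n z) - g z| ≤ kap ν * (M * bseq q ν n) := by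
    intro n z
    have := dist_le_tsum_of_dist_le_of_tendsto (f := fun n => f (π n z)) _
      (fun n => by rw [Real.dist_eq]; exact h1 n z) hs (hg z) n
    rw [Real.dist_eq, tsum_mul_left] at this
    have h3 := mul_le_mul_of_nonneg_left (bseq_tail q ν hq hν n) hM
    linarith
  have key : ∀ n z z', dist z z' ≤ (1 / 2) ^ (n + 1) →
      |g z - g z'| ≤ (2 * kap ν + 1) * M * bseq q ν n := by
    intro n z z' hd
    have a1 := hgd n z
    have a2 := hgd n z'
    have a3 := h2 n z z' (by
      have b1 := hπ n z
      have b2 := hπ n z'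
      have b3 := dist_triangle4 (π n z) z z' (π n z')
      rw [dist_comm (π n z) z] at b3
      linarith)
    rw [abs_le] at *
    constructor <;> nlinarith
  refine ⟨g, hg, ?_, ?_⟩
  · rw [Metric.continuous_iff]
    intro z ε hε
    have ht : Filter.Tendsto (fun n => (2 * kap ν + 1) * M * bseq q ν n) Filter.atTop (nhds 0) := by
      simpa using (bseq_summable q ν hq hν).tendsto_atTop_zero.const_mul ((2 * kap ν + 1) * M)
    obtain ⟨n, hn⟩ := (ht.eventually (gt_mem_nhds hε)).exists
    refine ⟨(1 / 2) ^ (n + 1), by positivity, fun y hy => ?_⟩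
    rw [Real.dist_eq]
    exact (key n y z hy.le).trans_lt hn
  · intro z z' hd
    rcases eq_or_ne z z' with rfl | hne
    · simp [Real.zero_rpow hν.ne']
    · obtain ⟨n, hn1, hn2⟩ := aux_scale q ν _ hq hν hν1 (dist_pos.2 hne) hd
      have hk := kap_nonneg ν
      calc _ ≤ _ := key n z z' hn1
        _ ≤ (2 * kap ν + 1) * M * (4 * (dist z z' ^ ν * |Real.log (dist z z')| ^ (1 / q))) := by
            gcongr
        _ = _ := by ring


lemma aux_tail {Ω : Type} [MeasureSpace Ω] [IsProbabilityMeasure (volume : Measure Ω)]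
    (q β B C : ℝ) (hq : 1 ≤ q) (hβ : 0 ≤ β) (hB : 0 < B) (hC : 0 ≤ C) (W : Ω → ENNReal)
    (hW : Measurable W) (hWi : ∫⁻ ω, W ω ∂(volume : Measure Ω) ≤ ENNReal.ofReal C)
    (u : ℝ) (hu : 0 < u) :
    (volume : Measure Ω) {ω | W ω ≠ ⊤ ∧ u ≤ B * (β + Real.log (1 + (W ω).toReal)) ^ (1 / q)} ≤
      ENNReal.ofReal ((1 + C) * Real.exp β * Real.exp (-(1 / B) ^ q * u ^ q)) := by
  have hq0 : 0 < q := by linarith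
  set e := Real.exp ((1 / B) ^ q * u ^ q - β) with he
  have hsub : {ω | W ω ≠ ⊤ ∧ u ≤ B * (β + Real.log (1 + (W ω).toReal)) ^ (1 / q)} ⊆
      {ω | ENNReal.ofReal e ≤ 1 + W ω} := by
    rintro ω ⟨hω, h⟩
    have hw : 0 ≤ (W ω).toReal := ENNReal.toReal_nonneg
    have hl : 0 ≤ Real.log (1 + (W ω).toReal) := Real.log_nonneg (by linarith)
    have h1 : (1 / B) * u ≤ (β + Real.log (1 + (W ω).toReal)) ^ (1 / q) := by
      rw [one_div, inv_mul_le_iff₀ hB]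
      exact h
    have h2 := Real.rpow_le_rpow (by positivity) h1 hq0.le
    rw [← Real.rpow_mul (by positivity), one_div_mul_cancel hq0.ne', Real.rpow_one,
      Real.mul_rpow (by positivity) hu.le] at h2
    have h3 : e ≤ 1 + (W ω).toReal := by
      rw [he, ← Real.le_log_iff_exp_le (by linarith)]
      linarith
    calc ENNReal.ofReal e ≤ ENNReal.ofReal (1 + (W ω).toReal) := ENNReal.ofReal_le_ofReal h3
      _ = 1 + W ω := by
        rw [ENNReal.ofReal_add zero_le_one hw, ENNReal.ofReal_toReal hω, ENNReal.ofReal_one]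
  have hep : 0 < e := Real.exp_pos _
  have hmk := meas_ge_le_lintegral_div (μ := (volume : Measure Ω)) (f := fun ω => 1 + W ω)
    (measurable_const.add hW).aemeasurable (ε := ENNReal.ofReal e)
    (by simpa using hep) ENNReal.ofReal_ne_top
  refine (measure_mono hsub).trans (hmk.trans ?_)
  rw [lintegral_add_left measurable_const]
  simp only [lintegral_const, measure_univ, mul_one]
  calc _ ≤ (1 + ENNReal.ofReal C) / ENNReal.ofReal e := by gcongr
    _ = ENNReal.ofReal ((1 + C) / e) := by
        rw [ENNReal.ofReal_div_of_pos hep, ENNReal.ofReal_add zero_le_one hC, ENNReal.ofReal_one]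
    _ = _ := by
        congr 1
        rw [he, div_eq_mul_inv, ← Real.exp_neg, mul_assoc, ← Real.exp_add]
        congr 2
        ring

/-- Chaining/Kolmogorov-type continuity criterion on a compact metric space with
polynomial covering numbers: if `‖X(z) − X(z')‖_{φ_q} ≤ c d(z,z')^ν` with
`φ_q(x) = exp(x^q) − 1`, then `X` admits a continuous modification `Y` whose modulus of
continuity is `K · d^ν |log d|^{1/q}`, where `K` has a stretched-exponential tail with
constants depending only on `c, θ, ν, q`. -/
theorem holder_modification_on_tree (q c θ ν : ℝ)
    (hq : 1 ≤ q) (hc : 0 < c) (hθ : 0 < θ) (hν : 0 < ν) (hν1 : ν ≤ 1) :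
    ∃ C₁ : ℝ, 0 < C₁ ∧ ∃ C₂ : ℝ, 0 < C₂ ∧
    ∀ (T : Type) [MetricSpace T] [CompactSpace T]
      (Ω : Type) [MeasureSpace Ω] [IsProbabilityMeasure (volume : Measure Ω)]
      (X : T → Ω → ℝ),
      (∀ z, Measurable (X z)) →
      -- covering numbers: `N(T,ε) ≤ c ε^{−θ}` for all `ε ∈ (0,1)`
      (∀ ε : ℝ, 0 < ε → ε < 1 → ∃ s : Finset T,
        (s.card : ℝ) ≤ c * ε ^ (-θ) ∧ ∀ x : T, ∃ y ∈ s, dist x y ≤ ε) →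
      -- Orlicz bound on increments: `‖X(z) − X(z')‖_{φ_q} ≤ c d(z,z')^ν`
      (∀ z z' : T, ∀ a : ℝ, c * dist z z' ^ ν < a →
        ∫⁻ ω, ENNReal.ofReal (Real.exp ((|X z ω - X z' ω| / a) ^ q) - 1) ∂(volume : Measure Ω)
          ≤ 1) →
      ∃ Y : T → Ω → ℝ,
        (∀ z, ∀ᵐ ω ∂(volume : Measure Ω), Y z ω = X z ω) ∧
        (∀ ω, Continuous fun z => Y z ω) ∧
        ∃ K : Ω → ℝ,
          (∀ u : ℝ, 0 < u →
            (volume : Measure Ω) {ω | u ≤ K ω} ≤ ENNReal.ofReal (C₁ * Real.exp (-C₂ * u ^ q))) ∧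
          ∀ ω, ∀ z z' : T, dist z z' < 1 / 2 →
            |Y z ω - Y z' ω| ≤ K ω * dist z z' ^ ν * |Real.log (dist z z')| ^ (1 / q) := by
  classical
  set β : ℝ := 3 * θ + 1 with hβ
  set C : ℝ := 2 * c ^ 2 with hC
  set A : ℝ := 3 * c + 1 with hA
  have hk := kap_nonneg ν
  have hβ0 : 0 < β := by positivity
  have hC0 : 0 < C := by positivity
  have hA0 : 0 < A := by positivity
  set B : ℝ := 4 * (2 * kap ν + 1) * A with hB
  have hB0 : 0 < B := by positivity
  refine ⟨(1 + C) * Real.exp β, by positivity, (1 / B) ^ q, by positivity, ?_⟩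
  intro T _ _ Ω _ _ X hX hcov hinc
  have hε0 : ∀ n : ℕ, (0 : ℝ) < (1 / 2) ^ (n + 1) := fun n => by positivity
  have hε1 : ∀ n : ℕ, ((1 : ℝ) / 2) ^ (n + 1) < 1 := fun n =>
    pow_lt_one₀ (by norm_num) (by norm_num) (Nat.succ_ne_zero n)
  choose s hscard hs using fun n : ℕ => hcov ((1 / 2) ^ (n + 1)) (hε0 n) (hε1 n)
  choose π hπs hπ using hs
  set a : ℕ → ℝ := fun n => A * (((1 : ℝ) / 2) ^ (n + 1)) ^ ν with ha
  have ha0 : ∀ n, 0 < a n := fun n => by positivity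
  have hint : ∀ n (z z' : T), dist z z' ≤ 3 * (1 / 2) ^ (n + 1) →
      ∫⁻ ω, ENNReal.ofReal (Real.exp ((|X z ω - X z' ω| / a n) ^ q) - 1) ∂(volume : Measure Ω)
        ≤ 1 := by
    intro n z z' hd
    apply hinc
    have hp : (0 : ℝ) < (((1 : ℝ) / 2) ^ (n + 1)) ^ ν := by positivity
    calc c * dist z z' ^ ν ≤ c * (3 * (1 / 2) ^ (n + 1)) ^ ν := by gcongr
      _ = c * (3 ^ ν * ((1 / 2) ^ (n + 1)) ^ ν) := by
          rw [Real.mul_rpow (by norm_num) (hε0 n).le]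
      _ ≤ c * (3 * ((1 / 2) ^ (n + 1)) ^ ν) := by
          gcongr
          calc (3 : ℝ) ^ ν ≤ 3 ^ (1 : ℝ) := Real.rpow_le_rpow_of_exponent_le (by norm_num) hν1
            _ = 3 := Real.rpow_one _
      _ < a n := by
          simp only [ha, hA]
          nlinarith
  have hcard : ∀ n, ((s n).card : ℝ) ≤ c * Real.exp (θ * (n + 1)) := by
    intro n
    refine (hscard n).trans ?_
    gcongr
    rw [Real.rpow_neg (hε0 n).le, ← Real.inv_rpow (hε0 n).le, ← inv_pow, one_div, inv_inv,
      mul_comm, Real.exp_mul]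
    apply Real.rpow_le_rpow (by positivity) _ hθ.le
    rw [← mul_one ((n : ℝ) + 1), ← Nat.cast_succ, Real.exp_nat_mul]
    have := Real.add_one_le_exp (1 : ℝ)
    gcongr
    linarith
  set P : ℕ → Finset (T × T) := fun n =>
    (s n ×ˢ (s n ∪ s (n + 1))).filter fun p => dist p.1 p.2 ≤ 3 * (1 / 2) ^ (n + 1) with hP
  have hPcard : ∀ n, ((P n).card : ℝ) ≤ C * Real.exp ((β - 1) * (n + 1)) := by
    intro n
    have hn : (0 : ℝ) ≤ n := Nat.cast_nonneg n
    have h1 : (P n).card ≤ (s n).card * ((s n).card + (s (n + 1)).card) := by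
      refine (Finset.card_filter_le _ _).trans ?_
      rw [Finset.card_product]
      exact Nat.mul_le_mul_left _ (Finset.card_union_le _ _)
    have h2 : ((P n).card : ℝ) ≤ (s n).card * ((s n).card + (s (n + 1)).card) := by
      exact_mod_cast h1
    have h3 := hcard n
    have h4 : ((s n).card : ℝ) ≤ c * Real.exp (2 * θ * (n + 1)) := h3.trans (by
      gcongr
      linarith)
    have h5 : ((s (n + 1)).card : ℝ) ≤ c * Real.exp (2 * θ * (n + 1)) := (hcard (n + 1)).trans (by
      refine mul_le_mul_of_nonneg_left (Real.exp_le_exp.2 ?_) hc.le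
      push_cast
      nlinarith)
    calc _ ≤ _ := h2
      _ ≤ c * Real.exp (θ * (n + 1)) *
          (c * Real.exp (2 * θ * (n + 1)) + c * Real.exp (2 * θ * (n + 1))) := by gcongr
      _ = C * (Real.exp (θ * (n + 1)) * Real.exp (2 * θ * (n + 1))) := by rw [hC]; ring
      _ = _ := by
          rw [← Real.exp_add, hβ]
          congr 2
          ring
  obtain ⟨W, hWm, hWi, hWb⟩ := aux_prob X hX q β C hq hβ0.le hC0.le a ha0 P hPcard
    (fun n p hp => hint n p.1 p.2 (Finset.mem_filter.1 hp).2)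
  have hWfin : ∀ᵐ ω ∂(volume : Measure Ω), W ω < ⊤ :=
    ae_lt_top hWm (ne_top_of_le_ne_top ENNReal.ofReal_ne_top hWi)
  have hL : ∀ ω, 0 ≤ (β + Real.log (1 + (W ω).toReal)) ^ (1 / q) := fun ω => by
    have hw : 0 ≤ (W ω).toReal := ENNReal.toReal_nonneg
    have hl : 0 ≤ Real.log (1 + (W ω).toReal) := Real.log_nonneg (by linarith)
    positivity
  have hdet : ∀ ω, W ω ≠ ⊤ → ∃ g : T → ℝ,
      (∀ z, Filter.Tendsto (fun n => X (π n z) ω) Filter.atTop (nhds (g z))) ∧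
      Continuous g ∧ ∀ z z', dist z z' < 1 / 2 →
        |g z - g z'| ≤ (B * (β + Real.log (1 + (W ω).toReal)) ^ (1 / q)) * dist z z' ^ ν
          * |Real.log (dist z z')| ^ (1 / q) := by
    intro ω hω
    have hstep : ∀ n x y, x ∈ s n → y ∈ s n ∪ s (n + 1) → dist x y ≤ 3 * (1 / 2) ^ (n + 1) →
        |X x ω - X y ω| ≤
          (A * (β + Real.log (1 + (W ω).toReal)) ^ (1 / q)) * bseq q ν n := by
      intro n x y hx hy hd
      have := hWb ω hω n (x, y) (Finset.mem_filter.2 ⟨Finset.mk_mem_product hx hy, hd⟩)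
      refine this.trans (le_of_eq ?_)
      simp only [ha, bseq]
      ring
    obtain ⟨g, hg1, hg2, hg3⟩ := aux_det q ν
      (A * (β + Real.log (1 + (W ω).toReal)) ^ (1 / q)) hq hν hν1
      (mul_nonneg hA0.le (hL ω)) (fun z => X z ω) π hπ
      (fun n z => hstep n _ _ (hπs n z) (Finset.mem_union_right _ (hπs (n + 1) z)) (by
        have b1 := hπ n z
        have b2 := hπ (n + 1) z
        have b3 := dist_triangle_left (π n z) (π (n + 1) z) z
        have b4 := hε0 n
        rw [pow_succ] at b2
        linarith))
      (fun n z z' hd => hstep n _ _ (hπs n z) (Finset.mem_union_left _ (hπs n z')) hd)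
    refine ⟨g, hg1, hg2, fun z z' hd => (hg3 z z' hd).trans (le_of_eq ?_)⟩
    rw [hB]
    ring
  choose! g hg1 hg2 hg3 using hdet
  refine ⟨fun z ω => if W ω = ⊤ then 0 else g ω z, ?_, ?_,
    fun ω => if W ω = ⊤ then 0 else B * (β + Real.log (1 + (W ω).toReal)) ^ (1 / q), ?_, ?_⟩
  · intro z
    obtain ⟨V, hVm, hVi, hVb⟩ := aux_prob X hX q 1 1 hq zero_le_one zero_le_one a ha0
      (fun n => {(z, π n z)}) (fun n => by simp) (fun n p hp => by
        rw [Finset.mem_singleton] at hp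
        subst hp
        apply hint
        have b1 := hπ n z
        have b4 := hε0 n
        linarith)
    have hVfin : ∀ᵐ ω ∂(volume : Measure Ω), V ω < ⊤ :=
      ae_lt_top hVm (ne_top_of_le_ne_top ENNReal.ofReal_ne_top hVi)
    filter_upwards [hWfin, hVfin] with ω hω hVω
    rw [if_neg hω.ne]
    refine tendsto_nhds_unique (hg1 ω hω.ne z) ?_
    rw [tendsto_iff_dist_tendsto_zero]
    refine squeeze_zero (g := fun n =>
      (A * (1 + Real.log (1 + (V ω).toReal)) ^ (1 / q)) * bseq q ν n)
      (fun n => dist_nonneg) (fun n => ?_) ?_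
    · rw [dist_comm, Real.dist_eq]
      refine (hVb ω hVω.ne n (z, π n z) (Finset.mem_singleton_self _)).trans (le_of_eq ?_)
      simp only [ha, bseq]
      ring
    · simpa using (bseq_summable q ν hq hν).tendsto_atTop_zero.const_mul
        (A * (1 + Real.log (1 + (V ω).toReal)) ^ (1 / q))
  · intro ω
    by_cases hω : W ω = ⊤
    · simp only [hω, if_true]
      exact continuous_const
    · simp only [hω, if_false]
      exact hg2 ω hω
  · intro u hu
    refine le_trans (measure_mono ?_) (aux_tail q β B C hq hβ0.le hB0 hC0.le W hWm hWi u hu)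
    intro ω hω
    simp only [mem_setOf_eq] at hω ⊢
    by_cases h : W ω = ⊤
    · rw [if_pos h] at hω
      linarith
    · rw [if_neg h] at hω
      exact ⟨h, hω⟩
  · intro ω z z' hd
    by_cases hω : W ω = ⊤
    · simp [hω]
    · simp only [hω, if_false]
      exact hg3 ω hω z z' hd
end
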